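/- Let q, z be complex numbers with q ≠ 0, z ≠ 0, and let m, n ≥ 0 be integers. Assume q^j ≠ 1 for all 1 ≤ j ≤ m+n, and z·q^{k-1} ≠ 1 for all 1 ≤ k ≤ max(m,n). Then ∑_{k=1}^{n} (q/z;q)_k · (z;q)_{n-k} · (z;q)_m · q^{m·k} · z^k / ( (q;q)_k · (q;q)_{n-k} · (q^k;q)_{m+1} ) − ∑_{k=1}^{m} (q/z;q)_k · (z;q)_{m-k} · (z;q)_n · q^{n·k} · z^k / ( (q;q)_k · (q;q)_{m-k} · (q^k;q)_{n+1} ) = (1 − z·q^{-1}) · (z;q)_m · (z;q)_n / ((q;q)_m · (q;q)_n) · ( ∑_{k=1}^{m} q^k/((1−z·q^{k-1})(1−q^k)) − ∑_{k=1}^{n} q^k/((1−z·q^{k-1})(1−q^k)) ). -/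

import Mathlib

open Finset

/-- The q-Pochhammer symbol `(x;q)_N = ∏_{j=0}^{N-1} (1 - x q^j)`. -/
noncomputable def qPoch (q x : ℂ) (N : ℕ) : ℂ := ∏ j ∈ Finset.range N, (1 - x * q ^ j)

/-- The coefficient `∏_{i < m - k} (b - a q^i) / (1 - q^{i+1})`, extended by zero to `k > m`. -/
noncomputable def pochRatio (q a b : ℂ) (m k : ℕ) : ℂ :=
  if k ≤ m then ∏ i ∈ range (m - k), (b - a * q ^ i) / (1 - q ^ (i + 1)) else 0

/-- The homogenized symbol `z^k (q/z;q)_k = ∏_{j=1}^{k} (z - q^j)`. -/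
noncomputable def homPoch (q z : ℂ) (k : ℕ) : ℂ := ∏ j ∈ range k, (z - q ^ (j + 1))

lemma qPoch_succ (q x : ℂ) (N : ℕ) : qPoch q x (N + 1) = qPoch q x N * (1 - x * q ^ N) :=
  prod_range_succ _ _

lemma qPoch_self_succ (q : ℂ) (N : ℕ) :
    qPoch q q (N + 1) = qPoch q q N * (1 - q ^ (N + 1)) := by
  rw [qPoch_succ, pow_succ']

lemma homPoch_succ (q z : ℂ) (k : ℕ) :
    homPoch q z (k + 1) = homPoch q z k * (z - q ^ (k + 1)) :=
  prod_range_succ _ _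

lemma qPoch_div_mul_pow {q z : ℂ} (hz : z ≠ 0) (k : ℕ) :
    qPoch q (q / z) k * z ^ k = homPoch q z k := by
  induction k with
  | zero => simp [qPoch, homPoch]
  | succ k ih =>
    rw [qPoch_succ, homPoch_succ, ← ih, pow_succ z, pow_succ q]
    field_simp

lemma qPoch_self_ne_zero {q : ℂ} {N : ℕ} (h : ∀ j, 1 ≤ j → j ≤ N → q ^ j ≠ 1) :
    qPoch q q N ≠ 0 := by
  refine prod_ne_zero_iff.2 fun j hj => ?_
  rw [← pow_succ']
  exact sub_ne_zero.2 (h (j + 1) (by omega) (by have := mem_range.1 hj; omega)).symm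

lemma qPoch_ne_zero {q z : ℂ} {N : ℕ} (h : ∀ k, 1 ≤ k → k ≤ N → z * q ^ (k - 1) ≠ 1) :
    qPoch q z N ≠ 0 := by
  refine prod_ne_zero_iff.2 fun j hj => ?_
  exact sub_ne_zero.2 (h (j + 1) (by omega) (by have := mem_range.1 hj; omega)).symm

lemma qPoch_self_mul_qPoch_pow (q : ℂ) (k m : ℕ) :
    qPoch q q k * qPoch q (q ^ k) (m + 1) = (1 - q ^ k) * qPoch q q (m + k) := by
  induction m with
  | zero =>
    simp [qPoch_succ, mul_comm, show qPoch q (q ^ k) 0 = 1 from rfl]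
  | succ m ih =>
    rw [qPoch_succ q (q ^ k), ← mul_assoc, ih, show m + 1 + k = m + k + 1 by ring,
      qPoch_self_succ]
    ring

lemma pochRatio_of_lt (q a b : ℂ) {m k : ℕ} (h : m < k) : pochRatio q a b m k = 0 :=
  if_neg (by omega)

lemma pochRatio_self (q a b : ℂ) (m : ℕ) : pochRatio q a b m m = 1 := by
  simp [pochRatio]

lemma pochRatio_succ_succ (q a b : ℂ) (m k : ℕ) :
    pochRatio q a b (m + 1) (k + 1) = pochRatio q a b m k := by
  simp [pochRatio]

lemma pochRatio_one_eq (q z : ℂ) {m k : ℕ} (h : k ≤ m) :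
    pochRatio q z 1 m k = qPoch q z (m - k) / qPoch q q (m - k) := by
  rw [pochRatio, if_pos h, prod_div_distrib]
  simp only [qPoch, pow_succ']

lemma pochRatio_succ_left {q : ℂ} (a b : ℂ) {m : ℕ} (h : ∀ j, 1 ≤ j → j ≤ m + 1 → q ^ j ≠ 1)
    (k : ℕ) :
    (q ^ k - q ^ (m + 1)) * pochRatio q a b (m + 1) k
      = (b * q ^ k - a * q ^ m) * pochRatio q a b m k := by
  rcases lt_trichotomy k (m + 1) with hk | rfl | hk
  · obtain ⟨j, rfl⟩ := Nat.exists_eq_add_of_le (Nat.lt_succ_iff.1 hk)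
    have hj : (1 : ℂ) - q ^ (j + 1) ≠ 0 :=
      sub_ne_zero.2 (h (j + 1) (by omega) (by omega)).symm
    rw [pochRatio, pochRatio, if_pos (by omega), if_pos (by omega),
      show k + j + 1 - k = j + 1 by omega, show k + j - k = j by omega, prod_range_succ]
    field_simp
    ring
  · simp [pochRatio_of_lt]
  · rw [pochRatio_of_lt _ _ _ hk, pochRatio_of_lt _ _ _ (by omega : m < k)]
    ring

lemma pochRatio_base_succ {q : ℂ} (z : ℂ) {m k : ℕ} (h : ∀ j, 1 ≤ j → j ≤ m + 1 → q ^ j ≠ 1)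
    (hk : k ≤ m) :
    (q ^ k - q ^ (m + 1)) * pochRatio q z q (m + 1) k
      = (q - z) * q ^ m * pochRatio q z 1 m k := by
  obtain ⟨j, rfl⟩ := Nat.exists_eq_add_of_le hk
  have hprod : ∀ i ≤ j, (1 - q ^ (i + 1)) *
      ∏ l ∈ range (i + 1), (q - z * q ^ l) / (1 - q ^ (l + 1))
        = (q - z) * q ^ i * ∏ l ∈ range i, (1 - z * q ^ l) / (1 - q ^ (l + 1)) := by
    intro i
    induction i with
    | zero =>
      intro _
      have h1 : (1 : ℂ) - q ≠ 0 := sub_ne_zero.2 (by simpa using (h 1 le_rfl (by omega)).symm)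
      simp
      field_simp
    | succ i ih =>
      intro hi
      have h1 : (1 : ℂ) - q ^ (i + 1) ≠ 0 :=
        sub_ne_zero.2 (h (i + 1) (by omega) (by omega)).symm
      have h2 : (1 : ℂ) - q ^ (i + 1 + 1) ≠ 0 :=
        sub_ne_zero.2 (h (i + 1 + 1) (by omega) (by omega)).symm
      have ih' := ih (by omega)
      rw [prod_range_succ _ (i + 1), prod_range_succ (fun l => (1 - z * q ^ l) / _) i]
      generalize ∏ l ∈ range (i + 1), (q - z * q ^ l) / (1 - q ^ (l + 1)) = A at *
      generalize ∏ l ∈ range i, (1 - z * q ^ l) / (1 - q ^ (l + 1)) = B at *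
      rw [mul_div_assoc', mul_div_cancel₀ _ h2, mul_div_assoc', mul_div_assoc', eq_div_iff h1]
      linear_combination q * (1 - z * q ^ i) * ih'
  rw [pochRatio, pochRatio, if_pos (by omega), if_pos hk,
    show k + j + 1 - k = j + 1 by omega, show k + j - k = j by omega]
  linear_combination q ^ k * hprod j le_rfl

lemma pow_sub_pow_ne_zero {q : ℂ} (hq : q ≠ 0) {m k : ℕ}
    (h : ∀ j, 1 ≤ j → j ≤ m + 1 → q ^ j ≠ 1) (hk : k ≤ m) : q ^ k - q ^ (m + 1) ≠ 0 := by
  obtain ⟨j, rfl⟩ := Nat.exists_eq_add_of_le hk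
  rw [add_assoc, pow_add, show q ^ k - q ^ k * q ^ (j + 1) = q ^ k * (1 - q ^ (j + 1)) by ring]
  exact mul_ne_zero (pow_ne_zero _ hq) (sub_ne_zero.2 (h (j + 1) (by omega) (by omega)).symm)

lemma pochRatio_sub {q : ℂ} (hq : q ≠ 0) (z : ℂ) {m k : ℕ}
    (h : ∀ j, 1 ≤ j → j ≤ m + 1 → q ^ j ≠ 1) (hk : k ≤ m + 1) :
    (1 - q ^ (m + 1)) * pochRatio q z 1 (m + 1) k - (1 - z * q ^ m) * pochRatio q z 1 m k
      = (1 - q ^ k) * pochRatio q z q (m + 1) k := by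
  rcases Nat.lt_succ_iff_lt_or_eq.1 (Nat.lt_succ_of_le hk) with hk | rfl
  · have hk := Nat.lt_succ_iff.1 hk
    apply mul_left_cancel₀ (pow_sub_pow_ne_zero hq h hk)
    linear_combination (1 - q ^ (m + 1)) * pochRatio_succ_left z 1 h k
      - (1 - q ^ k) * pochRatio_base_succ z h hk
  · simp [pochRatio_self, pochRatio_of_lt]

/-- The summand of the symmetric kernel, the mixed difference of `sideTerm`. -/
noncomputable def crossTerm (q z : ℂ) (m n k : ℕ) : ℂ :=
  homPoch q z k * pochRatio q z q (m + 1) k * (1 - q ^ k) * q ^ (n * k) / qPoch q q (n + 1 + k)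

/-- A sum over `k ≤ m + 1` that is symmetric in `m` and `n`. -/
noncomputable def crossSum (q z : ℂ) (m n : ℕ) : ℂ :=
  qPoch q q m * qPoch q q n * qPoch q z (n + 1) * ∑ k ∈ range (m + 2), crossTerm q z m n k

/-- The telescoping certificate for the contiguous relation of `crossTerm`. -/
noncomputable def crossCert (q z : ℂ) (m n k : ℕ) : ℂ :=
  homPoch q z k * pochRatio q z q (m + 2) k * (1 - q ^ k) * (q - q ^ k) * q ^ (n * k)
    / qPoch q q (n + 1 + k)

lemma crossTerm_contiguous {q : ℂ} (z : ℂ) {m n k : ℕ}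
    (h : ∀ j, 1 ≤ j → j ≤ m + n + 3 → q ^ j ≠ 1) :
    z * (q ^ (n + 1) - q ^ (m + 1)) * crossTerm q z m n k
      - q * (1 - q ^ (m + 1)) * crossTerm q z (m + 1) n k
      + q * (1 - q ^ (n + 1)) * (1 - z * q ^ (n + 1)) * crossTerm q z m (n + 1) k
      = crossCert q z m n (k + 1) - crossCert q z m n k := by
  have hE := pochRatio_succ_left z q (m := m + 1) (fun j h1 h2 => h j h1 (by omega)) k
  have hi : pochRatio q z q (m + 1) k * ((qPoch q q (n + 1 + k))⁻¹
      - (qPoch q q (n + 1 + k + 1))⁻¹ * (1 - q ^ (n + 1 + k + 1))) = 0 := by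
    rcases Nat.lt_or_ge (m + 1) k with hk' | hk'
    · rw [pochRatio_of_lt _ _ _ hk', zero_mul]
    · have h1 : (1 : ℂ) - q ^ (n + 1 + k + 1) ≠ 0 :=
        sub_ne_zero.2 (h _ (by omega) (by omega)).symm
      rw [qPoch_self_succ, mul_inv, inv_mul_cancel_right₀ h1, sub_self, mul_zero]
  simp only [crossTerm, crossCert, div_eq_mul_inv]
  rw [pochRatio_succ_succ, homPoch_succ, show n + 1 + 1 + k = n + 1 + k + 1 by ring,
    show n + 1 + (k + 1) = n + 1 + k + 1 by ring]
  simp only [show m + 1 + 1 = m + 2 by ring] at hE ⊢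
  generalize (qPoch q q (n + 1 + k))⁻¹ = i at *
  generalize (qPoch q q (n + 1 + k + 1))⁻¹ = i' at *
  generalize pochRatio q z q (m + 1) k = E₁ at *
  generalize pochRatio q z q (m + 2) k = E at *
  generalize homPoch q z k = p
  linear_combination (-p * q ^ (n * k) * (1 - q ^ k) * i) * hE
    + p * q ^ (n * k) * (1 - q ^ k) * (z * q ^ (n + 1) - q * q ^ k) * hi

lemma crossSum_contiguous {q : ℂ} (z : ℂ) {m n : ℕ}
    (h : ∀ j, 1 ≤ j → j ≤ m + n + 3 → q ^ j ≠ 1) :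
    z * (q ^ (n + 1) - q ^ (m + 1)) * crossSum q z m n
      - q * crossSum q z (m + 1) n + q * crossSum q z m (n + 1) = 0 := by
  have hext : ∀ n, ∑ k ∈ range (m + 2), crossTerm q z m n k
      = ∑ k ∈ range (m + 3), crossTerm q z m n k := fun n => by
    rw [sum_range_succ _ (m + 2), crossTerm, pochRatio_of_lt _ _ _ (by omega)]
    simp
  have htel := sum_range_sub (crossCert q z m n) (m + 3)
  rw [← sum_congr rfl fun k _ => crossTerm_contiguous z h, sum_add_distrib, sum_sub_distrib, ← mul_sum, ← mul_sum, ← mul_sum] at htel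
  have hend : crossCert q z m n (m + 3) - crossCert q z m n 0 = 0 := by
    rw [crossCert, crossCert, pochRatio_of_lt _ _ _ (by omega : m + 2 < m + 3)]
    simp
  rw [hend] at htel
  rw [crossSum, crossSum, crossSum, hext, hext, qPoch_self_succ, qPoch_self_succ,
    qPoch_succ q z (n + 1)]
  linear_combination qPoch q q m * qPoch q q n * qPoch q z (n + 1) * htel

lemma crossSum_comm_of_add_eq {q : ℂ} (hq : q ≠ 0) (z : ℂ) (s : ℕ)
    (h : ∀ j, 1 ≤ j → j ≤ s + 2 → q ^ j ≠ 1) :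
    ∀ m n, m + n = s → crossSum q z m n = crossSum q z n m := by
  induction s with
  | zero =>
    intro m n hmn
    obtain ⟨rfl, rfl⟩ : m = 0 ∧ n = 0 := by omega
    rfl
  | succ s ih =>
    have step : ∀ m n, m + n = s → crossSum q z (m + 1) n - crossSum q z n (m + 1)
        = crossSum q z m (n + 1) - crossSum q z (n + 1) m := by
      intro m n hmn
      have hc := ih (fun j h1 h2 => h j h1 (by omega)) m n hmn
      have h1 := crossSum_contiguous z (m := m) (n := n) fun j h1 h2 => h j h1 (by omega)
      have h2 := crossSum_contiguous z (m := n) (n := m) fun j h1 h2 => h j h1 (by omega)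
      apply mul_left_cancel₀ hq
      linear_combination -h1 - h2 + z * (q ^ (n + 1) - q ^ (m + 1)) * hc
    have hconst : ∀ m n, m + n = s + 1 → crossSum q z m n - crossSum q z n m
        = crossSum q z 0 (s + 1) - crossSum q z (s + 1) 0 := by
      intro m
      induction m with
      | zero =>
        intro n hn
        rw [show n = s + 1 by omega]
      | succ m ihm =>
        intro n hn
        rw [step m n (by omega), ihm (n + 1) (by omega)]
    intro m n hmn
    linear_combination (hconst m n hmn - hconst n m (by omega)) / 2

lemma crossSum_comm {q : ℂ} (hq : q ≠ 0) (z : ℂ) {m n : ℕ}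
    (h : ∀ j, 1 ≤ j → j ≤ m + n + 2 → q ^ j ≠ 1) : crossSum q z m n = crossSum q z n m :=
  crossSum_comm_of_add_eq hq z (m + n) h m n rfl

/-- The part of `sideTerm` that depends on `m` and `k`. -/
noncomputable def leftFactor (q z : ℂ) (m k : ℕ) : ℂ :=
  qPoch q q m / qPoch q z m * pochRatio q z 1 m k

/-- The part of `sideTerm` that depends on `n` and `k`. -/
noncomputable def rightFactor (q : ℂ) (n k : ℕ) : ℂ :=
  q ^ (n * k) * qPoch q q n / qPoch q q (n + k)

/-- The normalized summand of either sum on the left-hand side of the identity. -/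
noncomputable def sideTerm (q z : ℂ) (m n k : ℕ) : ℂ :=
  homPoch q z k * leftFactor q z m k * rightFactor q n k / (1 - q ^ k)

/-- The normalized sum on the left-hand side of the identity. -/
noncomputable def sideSum (q z : ℂ) (m n : ℕ) : ℂ := ∑ k ∈ Icc 1 m, sideTerm q z m n k

/-- The sum appearing on the right-hand side of the identity. -/
noncomputable def lambertSum (q z : ℂ) (m : ℕ) : ℂ :=
  ∑ k ∈ Icc 1 m, q ^ k / ((1 - z * q ^ (k - 1)) * (1 - q ^ k))

lemma sideSum_eq_sum_Icc_succ (q z : ℂ) (m n : ℕ) :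
    sideSum q z m n = ∑ k ∈ Icc 1 (m + 1), sideTerm q z m n k := by
  rw [sum_Icc_succ_top (by omega), sideTerm, leftFactor, pochRatio_of_lt _ _ _ (by omega)]
  simp [sideSum]

lemma leftFactor_sub {q z : ℂ} (hq : q ≠ 0) {m k : ℕ}
    (h : ∀ j, 1 ≤ j → j ≤ m + 1 → q ^ j ≠ 1)
    (hz : ∀ k, 1 ≤ k → k ≤ m + 1 → z * q ^ (k - 1) ≠ 1) (hk : k ≤ m + 1) :
    leftFactor q z (m + 1) k - leftFactor q z m k
      = qPoch q q m / qPoch q z (m + 1) * (1 - q ^ k) * pochRatio q z q (m + 1) k := by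
  have h1 := qPoch_ne_zero hz
  rw [qPoch_succ] at h1
  have h2 := left_ne_zero_of_mul h1
  have h3 := right_ne_zero_of_mul h1
  rw [leftFactor, leftFactor, mul_assoc, ← pochRatio_sub hq z h hk, qPoch_succ q z,
    qPoch_self_succ]
  field_simp

lemma rightFactor_sub {q : ℂ} {n k : ℕ} (h : ∀ j, 1 ≤ j → j ≤ n + 1 + k → q ^ j ≠ 1) :
    rightFactor q (n + 1) k - rightFactor q n k
      = -((1 - q ^ k) * qPoch q q n * q ^ (n * k) / qPoch q q (n + 1 + k)) := by
  have h1 := qPoch_self_ne_zero h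
  rw [show n + 1 + k = n + k + 1 by ring, qPoch_self_succ] at h1
  have h2 := left_ne_zero_of_mul h1
  have h3 := right_ne_zero_of_mul h1
  rw [rightFactor, rightFactor, show n + 1 + k = n + k + 1 by ring, qPoch_self_succ q (n + k),
    qPoch_self_succ q n]
  field_simp
  ring

lemma sideSum_mixed_difference {q z : ℂ} (hq : q ≠ 0) {m n : ℕ}
    (h : ∀ j, 1 ≤ j → j ≤ m + n + 2 → q ^ j ≠ 1)
    (hz : ∀ k, 1 ≤ k → k ≤ max m n + 1 → z * q ^ (k - 1) ≠ 1) :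
    sideSum q z (m + 1) (n + 1) - sideSum q z m (n + 1) - sideSum q z (m + 1) n
        + sideSum q z m n
      = -(crossSum q z m n / (qPoch q z (m + 1) * qPoch q z (n + 1))) := by
  have hzn : qPoch q z (n + 1) ≠ 0 := qPoch_ne_zero fun k h1 h2 => hz k h1 (by omega)
  have hrange : ∑ k ∈ range (m + 2), crossTerm q z m n k
      = ∑ k ∈ Icc 1 (m + 1), crossTerm q z m n k := by
    rw [range_eq_Ico, sum_eq_sum_Ico_succ_bot (by omega)]
    simp only [crossTerm, pow_zero, sub_self, mul_zero, zero_mul, zero_div, zero_add]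
    rfl
  rw [sideSum_eq_sum_Icc_succ q z m, sideSum_eq_sum_Icc_succ q z m, sideSum, sideSum,
    ← sum_sub_distrib, ← sum_sub_distrib, ← sum_add_distrib, crossSum, hrange, mul_sum, sum_div,
    ← sum_neg_distrib]
  refine sum_congr rfl fun k hk => ?_
  obtain ⟨hk1, hk2⟩ := mem_Icc.1 hk
  have hk0 : (1 : ℂ) - q ^ k ≠ 0 := sub_ne_zero.2 (h k hk1 (by omega)).symm
  have hl := leftFactor_sub hq (fun j h1 h2 => h j h1 (by omega))
    (fun k h1 h2 => hz k h1 (by omega)) hk2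
  have hr := rightFactor_sub (n := n) (k := k) fun j h1 h2 => h j h1 (by omega)
  calc _ = homPoch q z k * (leftFactor q z (m + 1) k - leftFactor q z m k)
        * (rightFactor q (n + 1) k - rightFactor q n k) / (1 - q ^ k) := by
        simp only [sideTerm]; ring
    _ = _ := by
        rw [hl, hr, crossTerm]
        field_simp

lemma sum_homPoch_mul_pochRatio_eq_zero {q : ℂ} (hq : q ≠ 0) (z : ℂ) {m : ℕ}
    (h : ∀ j, 1 ≤ j → j ≤ m + 1 → q ^ j ≠ 1) :
    ∑ k ∈ range (m + 2), homPoch q z k * pochRatio q z q (m + 1) k / qPoch q q k = 0 := by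
  set G : ℕ → ℂ := fun k =>
    homPoch q z k * pochRatio q z 1 (m + 1) k * (1 - q ^ k) / (q ^ k * qPoch q q k) with hG
  have hM : (1 : ℂ) - q ^ (m + 1) ≠ 0 := sub_ne_zero.2 (h _ (by omega) le_rfl).symm
  have hterm : ∀ k ∈ range (m + 2),
      -(1 - q ^ (m + 1)) * (homPoch q z k * pochRatio q z q (m + 1) k / qPoch q q k)
        = q ^ (m + 1) * (G (k + 1) - G k) := by
    intro k hk
    have hk := Nat.lt_succ_iff.1 (mem_range.1 hk)
    have hQ : qPoch q q k ≠ 0 := qPoch_self_ne_zero fun j h1 h2 => h j h1 (by omega)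
    simp only [hG]
    rw [pochRatio_succ_succ, homPoch_succ, qPoch_self_succ]
    rcases Nat.lt_succ_iff_lt_or_eq.1 (Nat.lt_succ_of_le hk) with hk | rfl
    · have h1 : (1 : ℂ) - q ^ (k + 1) ≠ 0 := sub_ne_zero.2 (h _ (by omega) (by omega)).symm
      have hk := Nat.lt_succ_iff.1 hk
      have key : -(1 - q ^ (m + 1)) * q ^ k * pochRatio q z q (m + 1) k
          = q ^ m * (z - q ^ (k + 1)) * pochRatio q z 1 m k
            - q ^ (m + 1) * (1 - q ^ k) * pochRatio q z 1 (m + 1) k := by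
        apply mul_left_cancel₀ (pow_sub_pow_ne_zero hq h hk)
        linear_combination -(1 - q ^ (m + 1)) * q ^ k * pochRatio_base_succ z h hk
          + q ^ (m + 1) * (1 - q ^ k) * pochRatio_succ_left z 1 h k
      rw [pow_succ q k] at h1 key ⊢
      field_simp
      linear_combination q * homPoch q z k * key
    · simp only [pochRatio_self, pochRatio_of_lt _ _ _ (Nat.lt_succ_self m)]
      field_simp
      ring
  have hsum := sum_congr rfl hterm
  rw [← mul_sum, ← mul_sum, sum_range_sub] at hsum
  have hend : G (m + 2) - G 0 = 0 := by
    simp [hG, pochRatio_of_lt]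
  rw [hend, mul_zero] at hsum
  exact (mul_eq_zero.1 hsum).resolve_left (neg_ne_zero.2 hM)

lemma sideSum_zero_right {q z : ℂ} (hq : q ≠ 0) {m : ℕ}
    (h : ∀ j, 1 ≤ j → j ≤ m → q ^ j ≠ 1)
    (hz : ∀ k, 1 ≤ k → k ≤ m → z * q ^ (k - 1) ≠ 1) :
    sideSum q z m 0 + (1 - z * q⁻¹) * lambertSum q z m = 0 := by
  induction m with
  | zero => simp [sideSum, lambertSum]
  | succ m ih =>
    have ih := ih (fun j h1 h2 => h j h1 (by omega)) fun k h1 h2 => hz k h1 (by omega)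
    have hzm := qPoch_ne_zero hz
    have hqm := qPoch_self_ne_zero h
    have hdiff : sideSum q z (m + 1) 0 - sideSum q z m 0
        = qPoch q q m / qPoch q z (m + 1) * ∑ k ∈ Icc 1 (m + 1),
          homPoch q z k * pochRatio q z q (m + 1) k / qPoch q q k := by
      rw [sideSum_eq_sum_Icc_succ q z m, sideSum, ← sum_sub_distrib, mul_sum]
      refine sum_congr rfl fun k hk => ?_
      obtain ⟨hk1, hk2⟩ := mem_Icc.1 hk
      have hk0 : (1 : ℂ) - q ^ k ≠ 0 := sub_ne_zero.2 (h k hk1 hk2).symm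
      have hl := leftFactor_sub hq h hz hk2
      calc _ = homPoch q z k * (leftFactor q z (m + 1) k - leftFactor q z m k)
            / qPoch q q k / (1 - q ^ k) := by
            simp only [sideTerm, rightFactor, zero_mul, pow_zero, zero_add,
              show qPoch q q 0 = 1 from rfl]
            ring
        _ = _ := by
            rw [hl]
            field_simp
    have hvan := sum_homPoch_mul_pochRatio_eq_zero hq z h
    rw [range_eq_Ico, sum_eq_sum_Ico_succ_bot (by omega)] at hvan
    change _ + ∑ k ∈ Icc 1 (m + 1), _ = 0 at hvan
    have hbase := pochRatio_base_succ z h (Nat.zero_le m)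
    rw [pochRatio_one_eq _ _ (Nat.zero_le m)] at hbase
    rw [eq_neg_of_add_eq_zero_right hvan] at hdiff
    have hlam : lambertSum q z (m + 1) = lambertSum q z m
        + q ^ (m + 1) / ((1 - z * q ^ m) * (1 - q ^ (m + 1))) := by
      rw [lambertSum, sum_Icc_succ_top (by omega)]
      rfl
    rw [qPoch_succ] at hzm
    rw [qPoch_self_succ] at hqm
    have hz1 := left_ne_zero_of_mul hzm
    have hz2 := right_ne_zero_of_mul hzm
    have hq1 := left_ne_zero_of_mul hqm
    have hq2 := right_ne_zero_of_mul hqm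
    have hg : pochRatio q z q (m + 1) 0
        = (q - z) * q ^ m * (qPoch q z m / qPoch q q m) / (1 - q ^ (m + 1)) := by
      rw [eq_div_iff hq2]
      simpa [mul_comm] using hbase
    have hval : sideSum q z (m + 1) 0 - sideSum q z m 0
        = -((1 - z * q⁻¹) * (q ^ (m + 1) / ((1 - z * q ^ m) * (1 - q ^ (m + 1))))) := by
      rw [hdiff, hg, qPoch_succ]
      simp only [homPoch, range_zero, prod_empty, show qPoch q q 0 = 1 from rfl]
      field_simp
      ring
    rw [hlam]
    linear_combination ih + hval

lemma sideSum_zero_left (q z : ℂ) (n : ℕ) :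
    sideSum q z 0 n + (1 - z * q⁻¹) * lambertSum q z 0 = 0 := by
  simp [sideSum, lambertSum]

lemma sideSum_add_lambertSum_comm {q z : ℂ} (hq : q ≠ 0) {m n : ℕ}
    (h : ∀ j, 1 ≤ j → j ≤ m + n → q ^ j ≠ 1)
    (hz : ∀ k, 1 ≤ k → k ≤ max m n → z * q ^ (k - 1) ≠ 1) :
    sideSum q z m n + (1 - z * q⁻¹) * lambertSum q z m
      = sideSum q z n m + (1 - z * q⁻¹) * lambertSum q z n := by
  induction m generalizing n with
  | zero =>
    rw [sideSum_zero_left, sideSum_zero_right hq (by simpa using h) (by simpa using hz)]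
  | succ m ihm =>
    induction n with
    | zero =>
      rw [sideSum_zero_left, sideSum_zero_right hq (by simpa using h) (by simpa using hz)]
    | succ n ihn =>
      have h1 := ihm (n := n) (fun j h1 h2 => h j h1 (by omega))
        fun k h1 h2 => hz k h1 (by omega)
      have h2 := ihm (n := n + 1) (fun j h1 h2 => h j h1 (by omega))
        fun k h1 h2 => hz k h1 (by omega)
      have h3 := ihn (fun j h1 h2 => h j h1 (by omega)) fun k h1 h2 => hz k h1 (by omega)
      have d1 := sideSum_mixed_difference hq (m := m) (n := n)
        (fun j h1 h2 => h j h1 (by omega)) fun k h1 h2 => hz k h1 (by omega)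
      have d2 := sideSum_mixed_difference hq (m := n) (n := m)
        (fun j h1 h2 => h j h1 (by omega)) fun k h1 h2 => hz k h1 (by omega)
      rw [crossSum_comm hq z fun j h1 h2 => h j h1 (by omega),
        mul_comm (qPoch q z (n + 1))] at d2
      linear_combination h2 + h3 - h1 + d1 - d2

lemma sum_eq_mul_sideSum {q z : ℂ} (hz0 : z ≠ 0) {m n : ℕ}
    (h : ∀ j, 1 ≤ j → j ≤ m + n → q ^ j ≠ 1)
    (hz : ∀ k, 1 ≤ k → k ≤ m → z * q ^ (k - 1) ≠ 1) :
    ∑ k ∈ Icc 1 m, qPoch q (q / z) k * qPoch q z (m - k) * qPoch q z n * q ^ (n * k) * z ^ k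
        / (qPoch q q k * qPoch q q (m - k) * qPoch q (q ^ k) (n + 1))
      = qPoch q z m * qPoch q z n / (qPoch q q m * qPoch q q n) * sideSum q z m n := by
  have hzm := qPoch_ne_zero hz
  have hqm : qPoch q q m ≠ 0 := qPoch_self_ne_zero fun j h1 h2 => h j h1 (by omega)
  have hqn : qPoch q q n ≠ 0 := qPoch_self_ne_zero fun j h1 h2 => h j h1 (by omega)
  rw [sideSum, mul_sum]
  refine sum_congr rfl fun k hk => ?_
  obtain ⟨hk1, hk2⟩ := mem_Icc.1 hk
  rw [mul_right_comm (qPoch q q k), qPoch_self_mul_qPoch_pow, sideTerm, leftFactor,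
    rightFactor, pochRatio_one_eq _ _ hk2, ← qPoch_div_mul_pow hz0]
  field_simp

theorem stmt_17 (q z : ℂ) (hq : q ≠ 0) (hz : z ≠ 0) (m n : ℕ)
    (hq1 : ∀ j : ℕ, 1 ≤ j → j ≤ m + n → q ^ j ≠ 1)
    (hz1 : ∀ k : ℕ, 1 ≤ k → k ≤ max m n → z * q ^ (k - 1) ≠ 1) :
    (∑ k ∈ Finset.Icc 1 n,
        qPoch q (q / z) k * qPoch q z (n - k) * qPoch q z m * q ^ (m * k) * z ^ k
          / (qPoch q q k * qPoch q q (n - k) * qPoch q (q ^ k) (m + 1)))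
      - (∑ k ∈ Finset.Icc 1 m,
          qPoch q (q / z) k * qPoch q z (m - k) * qPoch q z n * q ^ (n * k) * z ^ k
            / (qPoch q q k * qPoch q q (m - k) * qPoch q (q ^ k) (n + 1)))
      = (1 - z * q⁻¹) * qPoch q z m * qPoch q z n / (qPoch q q m * qPoch q q n)
          * ((∑ k ∈ Finset.Icc 1 m, q ^ k / ((1 - z * q ^ (k - 1)) * (1 - q ^ k)))
             - ∑ k ∈ Finset.Icc 1 n, q ^ k / ((1 - z * q ^ (k - 1)) * (1 - q ^ k))) := by
  rw [sum_eq_mul_sideSum hz (fun j h1 h2 => hq1 j h1 (by omega))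
      fun k h1 h2 => hz1 k h1 (by omega),
    sum_eq_mul_sideSum hz hq1 fun k h1 h2 => hz1 k h1 (by omega)]
  have hcomm := sideSum_add_lambertSum_comm hq hq1 hz1
  simp only [lambertSum] at hcomm
  linear_combination -(qPoch q z m * qPoch q z n / (qPoch q q m * qPoch q q n)) * hcomm
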